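/- Let G be a finite group generated by a set S, and let s ∈ S. The degree of any vertex ⟨s⟩g in the G-graph Γ(G,S) equals o(s)·(|S|−1), where o(s) is the order of s. -/

import Mathlib

/-- The right coset of the cyclic subgroup `⟨s⟩` containing `g`. -/
def rcoset {G : Type*} [Group G] (s g : G) : Set G := {x | ∃ k : ℤ, x = s ^ k * g}

/-- The finset of all right cosets of the cyclic subgroup `⟨s⟩` in a finite group `G`. -/
noncomputable def cosetsOf {G : Type*} [Group G] [Fintype G] (s : G) : Finset (Set G) :=
  @Finset.image _ _ (Classical.decEq _) (fun g => rcoset s g) Finset.univ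

/-- The degree (counting edge multiplicities) of the vertex `⟨s⟩g` in the G-graph `Γ(G,S)`:
the total number of edges from `⟨s⟩g` to cosets of the other generators, where the number of
edges between `⟨s⟩g` and a coset `C` of `⟨t⟩` (`t ≠ s`) is `|⟨s⟩g ∩ C|`. -/
noncomputable def gDeg {G : Type*} [Group G] [Fintype G] [DecidableEq G]
    (S : Finset G) (s g : G) : ℕ :=
  ∑ t ∈ S.erase s, ∑ C ∈ cosetsOf t, Nat.card ↥(rcoset s g ∩ C)

theorem rcoset_eq_iff_mem {G : Type*} [Group G] (t x h : G) :
    rcoset t x = rcoset t h ↔ x ∈ rcoset t h := by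
  constructor
  · intro e
    rw [← e]
    exact ⟨0, by simp⟩
  · rintro ⟨k, rfl⟩
    ext y
    constructor
    · rintro ⟨m, rfl⟩
      exact ⟨m + k, by rw [zpow_add, mul_assoc]⟩
    · rintro ⟨m, rfl⟩
      exact ⟨m - k, by rw [← mul_assoc, ← zpow_add, sub_add_cancel]⟩

theorem ncard_rcoset {G : Type*} [Group G] (s g : G) :
    (rcoset s g).ncard = orderOf s := by
  have h : rcoset s g = (fun x => x * g) '' (Subgroup.zpowers s : Set G) := by
    ext x
    simp [rcoset, Subgroup.mem_zpowers_iff, eq_mul_inv_iff_mul_eq, eq_comm (a := x)]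
  rw [h, Set.ncard_image_of_injective _ (mul_left_injective g), ← Nat.card_zpowers]
  rfl

/-- The right cosets of `⟨t⟩` partition any subset of the group. -/
theorem sum_card_inter_cosetsOf {G : Type*} [Group G] [Fintype G] (t : G) (A : Set G) :
    ∑ C ∈ cosetsOf t, Nat.card ↥(A ∩ C) = A.ncard := by
  classical
  rw [Set.ncard_eq_toFinset_card' A,
    Finset.card_eq_sum_card_fiberwise (f := rcoset t) (t := cosetsOf t)
      (fun x _ => by simp [cosetsOf])]
  refine Finset.sum_congr rfl fun C hC => ?_
  obtain ⟨h, rfl⟩ : ∃ h, rcoset t h = C := by simpa [cosetsOf] using hC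
  rw [Nat.card_coe_set_eq, Set.ncard_eq_toFinset_card']
  congr 1
  ext x
  simp [rcoset_eq_iff_mem]

/-- in the G-graph `Γ(G,S)` of a finite group `G` generated by `S`,
the degree of any vertex `⟨s⟩g` (for `s ∈ S`) equals `o(s)·(|S|−1)`. -/
theorem gDeg_eq_orderOf_mul {G : Type*} [Group G] [Fintype G] [DecidableEq G]
    (S : Finset G) (hS : Subgroup.closure (S : Set G) = ⊤)
    {s : G} (hs : s ∈ S) (g : G) :
    gDeg S s g = orderOf s * (S.card - 1) := by
  simp only [gDeg, sum_card_inter_cosetsOf, ncard_rcoset, Finset.sum_const,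
    Finset.card_erase_of_mem hs, smul_eq_mul]
  exact mul_comm _ _
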